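/- Assume the project is PCL-indexable, i.e., conditions (PCLI1), (PCLI2) and (PCLI3) hold. Then for every finite threshold z ∈ ℝ: max_{x ≤ z} m(x,z) = m*(z) = inf_{x > z} m(x,z), with the maximum on the left attained at x = z. Moreover, inf_{x ∈ ℝ} m(x,−∞) = lim_{z → −∞} m*(z) and sup_{x ∈ ℝ} m(x,∞) = lim_{z → ∞} m*(z) (the latter possibly +∞). -/

import Mathlib

open MeasureTheory ProbabilityTheory Filter Topology Set

noncomputable section

/-- A restless bandit project: the model data (discount factor `β`, passive/active
Markov transition kernels `κ false`/`κ true`, reward `r` and resource consumption `c`),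
Assumption 1 (the weighted sup-norm conditions for weight `w` and constants `M`, `γ`),
together with the threshold-policy performance metrics `F`, `G` (for `z`-policies,
active iff `x > z`), `Fm`, `Gm` (for `z⁻`-policies, active iff `x ≥ z`), and the
optimal value function `V lam` of the `lam`-price problem, each of which is the
(unique) `w`-bounded measurable solution of its fixed-point equation. -/
structure Bandit where
  β : ℝ
  κ : Bool → Kernel ℝ ℝ
  r : ℝ → Bool → ℝ
  c : ℝ → Bool → ℝ
  w : ℝ → ℝ
  M : ℝ
  γ : ℝ
  F : ℝ → EReal → ℝ
  G : ℝ → EReal → ℝ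
  Fm : ℝ → EReal → ℝ
  Gm : ℝ → EReal → ℝ
  V : ℝ → ℝ → ℝ
  hβ0 : 0 ≤ β
  hβ1 : β < 1
  hκ : ∀ a, IsMarkovKernel (κ a)
  hr_cont : ∀ a, Continuous fun x => r x a
  hc_cont : ∀ a, Continuous fun x => c x a
  hc0 : ∀ x, 0 ≤ c x false
  hc01 : ∀ x, c x false < c x true
  hw_meas : Measurable w
  hw_one : ∀ x, 1 ≤ w x
  hM : 0 < M
  hβγ : β ≤ γ
  hγ1 : γ < 1
  hr_bd : ∀ x a, |r x a| ≤ M * w x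
  hc_bd : ∀ x a, c x a ≤ M * w x
  hw_int : ∀ a x, Integrable w (κ a x)
  hw_drift : ∀ a x, β * ∫ y, w y ∂(κ a x) ≤ γ * w x
  hF_meas : ∀ z, Measurable fun x => F x z
  hG_meas : ∀ z, Measurable fun x => G x z
  hFm_meas : ∀ z, Measurable fun x => Fm x z
  hGm_meas : ∀ z, Measurable fun x => Gm x z
  hV_meas : ∀ lam, Measurable (V lam)
  hF_bdd : ∀ z, ∃ C, ∀ x, |F x z| ≤ C * w x
  hG_bdd : ∀ z, ∃ C, ∀ x, |G x z| ≤ C * w x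
  hFm_bdd : ∀ z, ∃ C, ∀ x, |Fm x z| ≤ C * w x
  hGm_bdd : ∀ z, ∃ C, ∀ x, |Gm x z| ≤ C * w x
  hV_bdd : ∀ lam, ∃ C, ∀ x, |V lam x| ≤ C * w x
  hF_eq : ∀ x z, F x z =
    r x (decide (z < (x : EReal))) +
      β * ∫ y, F y z ∂(κ (decide (z < (x : EReal))) x)
  hG_eq : ∀ x z, G x z =
    c x (decide (z < (x : EReal))) +
      β * ∫ y, G y z ∂(κ (decide (z < (x : EReal))) x)
  hFm_eq : ∀ x z, Fm x z =
    r x (decide (z ≤ (x : EReal))) +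
      β * ∫ y, Fm y z ∂(κ (decide (z ≤ (x : EReal))) x)
  hGm_eq : ∀ x z, Gm x z =
    c x (decide (z ≤ (x : EReal))) +
      β * ∫ y, Gm y z ∂(κ (decide (z ≤ (x : EReal))) x)
  hV_eq : ∀ lam x, V lam x =
    max (r x false - lam * c x false + β * ∫ y, V lam y ∂(κ false x))
        (r x true - lam * c x true + β * ∫ y, V lam y ∂(κ true x))

/-- `ν` is the Lebesgue–Stieltjes measure of the (bounded nonincreasing
right-continuous) function `h`: `ν(z₁,z₂] = h z₁ - h z₂`. -/
def IsLSMeasureOfAnti (h : ℝ → ℝ) (ν : Measure ℝ) : Prop :=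
  ∀ z₁ z₂ : ℝ, z₁ ≤ z₂ → ν (Set.Ioc z₁ z₂) = ENNReal.ofReal (h z₁ - h z₂)

/-- `ν` is the Lebesgue–Stieltjes measure of the (bounded nondecreasing
right-continuous) function `h`: `ν(z₁,z₂] = h z₂ - h z₁`. -/
def IsLSMeasureOfMono (h : ℝ → ℝ) (ν : Measure ℝ) : Prop :=
  ∀ z₁ z₂ : ℝ, z₁ ≤ z₂ → ν (Set.Ioc z₁ z₂) = ENNReal.ofReal (h z₂ - h z₁)

/-- The real interval `(z₁, z₂] ⊆ ℝ` with extended-real endpoints. -/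
def iocR (z₁ z₂ : EReal) : Set ℝ := {y : ℝ | z₁ < (y : EReal) ∧ (y : EReal) ≤ z₂}

/-- `t`-step distribution of the Markov chain with kernel `κ` and initial law `p`. -/
def kerIter (κ : Kernel ℝ ℝ) : ℕ → Measure ℝ → Measure ℝ
  | 0, p => p
  | (t + 1), p => (kerIter κ t p).bind fun x => κ x

namespace Bandit

variable (P : Bandit)

/-- Marginal reward metric `f(x,z)` of the `z`-policy. -/
def f (x : ℝ) (z : EReal) : ℝ :=
  (P.r x true - P.r x false) +
    P.β * ((∫ y, P.F y z ∂(P.κ true x)) - ∫ y, P.F y z ∂(P.κ false x))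

/-- Marginal resource metric `g(x,z)` of the `z`-policy. -/
def g (x : ℝ) (z : EReal) : ℝ :=
  (P.c x true - P.c x false) +
    P.β * ((∫ y, P.G y z ∂(P.κ true x)) - ∫ y, P.G y z ∂(P.κ false x))

/-- Marginal reward metric `f(x,z⁻)` of the `z⁻`-policy. -/
def fm (x : ℝ) (z : EReal) : ℝ :=
  (P.r x true - P.r x false) +
    P.β * ((∫ y, P.Fm y z ∂(P.κ true x)) - ∫ y, P.Fm y z ∂(P.κ false x))

/-- Marginal resource metric `g(x,z⁻)` of the `z⁻`-policy. -/
def gm (x : ℝ) (z : EReal) : ℝ :=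
  (P.c x true - P.c x false) +
    P.β * ((∫ y, P.Gm y z ∂(P.κ true x)) - ∫ y, P.Gm y z ∂(P.κ false x))

/-- Marginal productivity metric `m(x,z) = f(x,z)/g(x,z)`. -/
def m (x : ℝ) (z : EReal) : ℝ := P.f x z / P.g x z

/-- Marginal productivity metric `m(x,z⁻) = f(x,z⁻)/g(x,z⁻)`. -/
def mm (x : ℝ) (z : EReal) : ℝ := P.fm x z / P.gm x z

/-- The marginal productivity (MP) index `m*(x) = m(x,x)`. -/
def mStar (x : ℝ) : ℝ := P.m x (x : EReal)

/-- The active action is `P_lam`-optimal at `x`. -/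
def ActOpt (lam x : ℝ) : Prop :=
  P.r x false - lam * P.c x false + P.β * ∫ y, P.V lam y ∂(P.κ false x) ≤
    P.r x true - lam * P.c x true + P.β * ∫ y, P.V lam y ∂(P.κ true x)

/-- The passive action is `P_lam`-optimal at `x`. -/
def PassOpt (lam x : ℝ) : Prop :=
  P.r x true - lam * P.c x true + P.β * ∫ y, P.V lam y ∂(P.κ true x) ≤
    P.r x false - lam * P.c x false + P.β * ∫ y, P.V lam y ∂(P.κ false x)

/-- The project is indexable with index `ν`. -/
def Indexable (ν : ℝ → ℝ) : Prop :=
  ∀ lam x, (P.ActOpt lam x ↔ lam ≤ ν x) ∧ (P.PassOpt lam x ↔ ν x ≤ lam)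

/-- The `z`-policy is `P_lam`-optimal. -/
def ZPolicyOpt (z : EReal) (lam : ℝ) : Prop :=
  ∀ x, P.F x z - lam * P.G x z = P.V lam x

/-- The `z⁻`-policy is `P_lam`-optimal. -/
def ZmPolicyOpt (z : EReal) (lam : ℝ) : Prop :=
  ∀ x, P.Fm x z - lam * P.Gm x z = P.V lam x

/-- The project is strongly threshold-indexable with index `ν`. -/
def StronglyThresholdIndexable (ν : ℝ → ℝ) : Prop :=
  P.Indexable ν ∧
    ∀ lam : ℝ, ∃ z : EReal, P.ZPolicyOpt z lam ∧ P.ZmPolicyOpt z lam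

/-- PCL-indexability condition (PCLI1). -/
def PCLI1 : Prop := ∀ (x : ℝ) (z : EReal), 0 < P.g x z

/-- PCL-indexability condition (PCLI2). -/
def PCLI2 : Prop :=
  Monotone P.mStar ∧ Continuous P.mStar ∧ BddBelow (Set.range P.mStar)

/-- PCL-indexability condition (PCLI3). -/
def PCLI3 : Prop :=
  ∀ x : ℝ, ∀ ν : Measure ℝ, IsLSMeasureOfAnti (fun z : ℝ => P.G x z) ν →
    ∀ z₁ z₂ : ℝ, z₁ < z₂ →
      P.F x z₂ - P.F x z₁ = -∫ z in Set.Ioc z₁ z₂, P.mStar z ∂ν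

/-- The project is PCL-indexable. -/
def PCLIndexable : Prop := P.PCLI1 ∧ P.PCLI2 ∧ P.PCLI3

/-- Reward metric with initial distribution `p`. -/
def Fp (p : Measure ℝ) (z : EReal) : ℝ := ∫ x, P.F x z ∂p

/-- Resource metric with initial distribution `p`. -/
def Gp (p : Measure ℝ) (z : EReal) : ℝ := ∫ x, P.G x z ∂p

/-- `z⁻`-policy reward metric with initial distribution `p`. -/
def Fmp (p : Measure ℝ) (z : EReal) : ℝ := ∫ x, P.Fm x z ∂p

/-- `z⁻`-policy resource metric with initial distribution `p`. -/
def Gmp (p : Measure ℝ) (z : EReal) : ℝ := ∫ x, P.Gm x z ∂p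

/-- An admissible initial distribution: a probability measure with `∫ w dp < ∞`. -/
def IsInitDist (p : Measure ℝ) : Prop :=
  IsProbabilityMeasure p ∧ Integrable P.w p

/-- The transition kernel of the `z`-policy (active iff `x > z`). -/
def thrKer (z : EReal) : Kernel ℝ ℝ :=
  haveI : DecidablePred (· ∈ {x : ℝ | z < (x : EReal)}) := Classical.decPred _
  Kernel.piecewise
    (show MeasurableSet {x : ℝ | z < (x : EReal)} from
      measurable_coe_real_ereal measurableSet_Ioi)
    (P.κ true) (P.κ false)

/-- The transition kernel of the `z⁻`-policy (active iff `x ≥ z`). -/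
def thrKerM (z : EReal) : Kernel ℝ ℝ :=
  haveI : DecidablePred (· ∈ {x : ℝ | z ≤ (x : EReal)}) := Classical.decPred _
  Kernel.piecewise
    (show MeasurableSet {x : ℝ | z ≤ (x : EReal)} from
      measurable_coe_real_ereal measurableSet_Ici)
    (P.κ true) (P.κ false)

/-- The (discounted) state occupation measure `μ_p^z` of the `z`-policy. -/
def occ (z : EReal) (p : Measure ℝ) : Measure ℝ :=
  Measure.sum fun t : ℕ => ENNReal.ofReal (P.β ^ t) • kerIter (P.thrKer z) t p

/-- The (discounted) state occupation measure `μ_p^{z⁻}` of the `z⁻`-policy. -/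
def occM (z : EReal) (p : Measure ℝ) : Measure ℝ :=
  Measure.sum fun t : ℕ => ENNReal.ofReal (P.β ^ t) • kerIter (P.thrKerM z) t p

end Bandit

/-- Finite-horizon reward metric `F_k(x,z)` (value iteration). -/
def Bandit.Fk (P : Bandit) : ℕ → ℝ → EReal → ℝ
  | 0, x, z => P.r x (decide (z < (x : EReal)))
  | (k + 1), x, z =>
      P.r x (decide (z < (x : EReal))) +
        P.β * ∫ y, Bandit.Fk P k y z ∂(P.κ (decide (z < (x : EReal))) x)

/-- Finite-horizon resource metric `G_k(x,z)` (value iteration). -/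
def Bandit.Gk (P : Bandit) : ℕ → ℝ → EReal → ℝ
  | 0, x, z => P.c x (decide (z < (x : EReal)))
  | (k + 1), x, z =>
      P.c x (decide (z < (x : EReal))) +
        P.β * ∫ y, Bandit.Gk P k y z ∂(P.κ (decide (z < (x : EReal))) x)

/-- Finite-horizon marginal reward metric `f_k(x,z)`. -/
def Bandit.fk (P : Bandit) : ℕ → ℝ → EReal → ℝ
  | 0, x, _ => P.r x true - P.r x false
  | (k + 1), x, z =>
      (P.r x true - P.r x false) +
        P.β * ((∫ y, P.Fk k y z ∂(P.κ true x)) - ∫ y, P.Fk k y z ∂(P.κ false x))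

/-- Finite-horizon marginal resource metric `g_k(x,z)`. -/
def Bandit.gk (P : Bandit) : ℕ → ℝ → EReal → ℝ
  | 0, x, _ => P.c x true - P.c x false
  | (k + 1), x, z =>
      (P.c x true - P.c x false) +
        P.β * ((∫ y, P.Gk k y z ∂(P.κ true x)) - ∫ y, P.Gk k y z ∂(P.κ false x))

namespace Bandit

variable (P : Bandit)

/-- Finite-horizon MP metric `m_k(x,z)`. -/
def mk' (k : ℕ) (x : ℝ) (z : EReal) : ℝ := P.fk k x z / P.gk k x z

/-- Finite-horizon MP index `m*_k(x)`. -/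
def mkStar (k : ℕ) (x : ℝ) : ℝ := P.mk' k x (x : EReal)

/-- `g̲(x,z) = inf_k g_k(x,z)`. -/
def gbar (x : ℝ) (z : EReal) : ℝ := ⨅ k : ℕ, P.gk k x z

end Bandit

/-- Locally antitone up to a vanishing error implies antitone: if the increments of `ψ` are
bounded by products of increments of a continuous monotone and an antitone function, then
`ψ` is antitone. -/
theorem antitone_of_increment_le_mul {ψ μ a : ℝ → ℝ} (hμm : Monotone μ) (hμc : Continuous μ)
    (ha : Antitone a)
    (h : ∀ s t, s ≤ t → ψ t - ψ s ≤ (μ t - μ s) * (a s - a t)) : Antitone ψ := by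
  intro x z hxz
  have key : ∀ ε > 0, ψ z + ε * a z ≤ ψ x + ε * a x := by
    intro ε hε
    have huc : UniformContinuousOn μ (Icc x z) :=
      isCompact_Icc.uniformContinuousOn_of_continuous hμc.continuousOn
    obtain ⟨δ, hδ, hδ'⟩ := Metric.uniformContinuousOn_iff.1 huc ε hε
    have step : ∀ n : ℕ, ∀ s t, x ≤ s → s ≤ t → t ≤ z → t - s ≤ n * (δ / 2) →
        ψ t + ε * a t ≤ ψ s + ε * a s := by
      intro n
      induction n with
      | zero =>
        intro s t _ hst _ hd
        have : t = s := by
          norm_num at hd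
          linarith
        rw [this]
      | succ n ih =>
        intro s t hs hst ht hd
        push_cast at hd
        set u := max s (t - δ / 2)
        have hsu : s ≤ u := le_max_left _ _
        have hut : u ≤ t := max_le hst (by linarith)
        have h₁ : ψ u + ε * a u ≤ ψ s + ε * a s := by
          apply ih s u hs hsu (hut.trans ht)
          have : u ≤ s + n * (δ / 2) :=
            max_le (by have := hδ.le; nlinarith [(Nat.cast_nonneg n : (0 : ℝ) ≤ n)]) (by linarith)
          linarith
        have hu : t - δ / 2 ≤ u := le_max_right _ _
        have h₂ := h u t hut
        have h₃ := hδ' t ⟨hs.trans hst, ht⟩ u ⟨hs.trans hsu, hut.trans ht⟩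
          (by rw [Real.dist_eq, abs_of_nonneg (by linarith)]; linarith)
        rw [Real.dist_eq, abs_of_nonneg (sub_nonneg.2 (hμm hut))] at h₃
        have h₄ : 0 ≤ a u - a t := sub_nonneg.2 (ha hut)
        nlinarith [mul_le_mul_of_nonneg_right h₃.le h₄]
    obtain ⟨n, hn⟩ := exists_nat_ge ((z - x) / (δ / 2))
    exact step n x z le_rfl hxz le_rfl ((div_le_iff₀ (by linarith)).1 hn)
  have hA : 0 ≤ a x - a z := sub_nonneg.2 (ha hxz)
  refine le_of_forall_pos_le_add fun η hη => ?_
  have h₁ := key (η / (a x - a z + 1)) (by positivity)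
  have h₂ : η / (a x - a z + 1) * (a x - a z) ≤ η := by
    rw [div_mul_eq_mul_div, div_le_iff₀ (by linarith)]
    nlinarith
  linarith

namespace Bandit

variable (P : Bandit)

/-- `H` is the threshold-policy performance metric of the one-period payoff `ρ`. -/
structure IsMetric (ρ : ℝ → Bool → ℝ) (H : ℝ → EReal → ℝ) : Prop where
  payoff_bdd : ∃ K, 0 ≤ K ∧ ∀ x a, |ρ x a| ≤ K * P.w x
  meas : ∀ z, Measurable fun x => H x z
  bdd : ∀ z, ∃ C, ∀ x, |H x z| ≤ C * P.w x
  eq : ∀ x z, H x z = ρ x (decide (z < (x : EReal))) +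
    P.β * ∫ y, H y z ∂(P.κ (decide (z < (x : EReal))) x)

/-- The marginal metric of a payoff `ρ` with performance metric `H`. -/
def marg (ρ : ℝ → Bool → ℝ) (H : ℝ → EReal → ℝ) (x : ℝ) (z : EReal) : ℝ :=
  (ρ x true - ρ x false) +
    P.β * ((∫ y, H y z ∂(P.κ true x)) - ∫ y, H y z ∂(P.κ false x))

variable {P}

theorem w_pos (x : ℝ) : 0 < P.w x := one_pos.trans_le (P.hw_one x)

theorem integrable_of_abs_le {φ : ℝ → ℝ} (hφ : Measurable φ) {C : ℝ}
    (hC : ∀ x, |φ x| ≤ C * P.w x) (a : Bool) (x : ℝ) : Integrable φ (P.κ a x) :=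
  ((P.hw_int a x).const_mul C).mono' hφ.aestronglyMeasurable (ae_of_all _ hC)

theorem discounted_integral_le {φ : ℝ → ℝ} {a : Bool} {x : ℝ} (hφ : Integrable φ (P.κ a x))
    {C : ℝ} (hC0 : 0 ≤ C) (hC : ∀ x, φ x ≤ C * P.w x) :
    P.β * ∫ y, φ y ∂(P.κ a x) ≤ C * P.γ * P.w x := by
  have h₁ : ∫ y, φ y ∂(P.κ a x) ≤ C * ∫ y, P.w y ∂(P.κ a x) := by
    rw [← integral_const_mul]
    exact integral_mono hφ ((P.hw_int a x).const_mul C) hC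
  have h₂ := mul_le_mul_of_nonneg_left h₁ P.hβ0
  have h₃ := mul_le_mul_of_nonneg_left (P.hw_drift a x) hC0
  linarith

theorem gamma_nonneg : 0 ≤ P.γ := P.hβ0.trans P.hβγ

/-- Maximum principle: a `w`-bounded subsolution of the homogeneous equation is nonpositive. -/
theorem nonpos_of_le_discounted_integral {φ : ℝ → ℝ} (hφ : Measurable φ) {C : ℝ}
    (hC : ∀ x, |φ x| ≤ C * P.w x)
    (h : ∀ x, ∃ a, φ x ≤ P.β * ∫ y, φ y ∂(P.κ a x)) (x : ℝ) : φ x ≤ 0 := by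
  have hC0 : 0 ≤ C := nonneg_of_mul_nonneg_left ((abs_nonneg _).trans (hC 0)) (w_pos 0)
  have hk : ∀ (k : ℕ) x, φ x ≤ C * P.γ ^ k * P.w x := by
    intro k
    induction k with
    | zero => intro x; simpa using (le_abs_self _).trans (hC x)
    | succ k ih =>
      intro x
      obtain ⟨a, ha⟩ := h x
      have := discounted_integral_le (integrable_of_abs_le hφ hC a x)
        (mul_nonneg hC0 (pow_nonneg gamma_nonneg k)) ih
      calc φ x ≤ _ := ha
        _ ≤ _ := this
        _ = _ := by ring
  have hlim : Tendsto (fun k : ℕ => C * P.γ ^ k * P.w x) atTop (𝓝 (C * 0 * P.w x)) :=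
    ((tendsto_pow_atTop_nhds_zero_of_lt_one gamma_nonneg P.hγ1).const_mul C).mul_const _
  simpa using ge_of_tendsto' hlim fun k => hk k x

theorem isMetric_F : P.IsMetric P.r P.F :=
  ⟨⟨P.M, P.hM.le, P.hr_bd⟩, P.hF_meas, P.hF_bdd, P.hF_eq⟩

theorem isMetric_G : P.IsMetric P.c P.G := by
  refine ⟨⟨P.M, P.hM.le, fun x a => ?_⟩, P.hG_meas, P.hG_bdd, P.hG_eq⟩
  have : 0 ≤ P.c x a := by
    cases a
    · exact P.hc0 x
    · exact (P.hc0 x).trans (P.hc01 x).le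
  rw [abs_of_nonneg this]
  exact P.hc_bd x a

namespace IsMetric

variable {ρ ρ' : ℝ → Bool → ℝ} {H H' : ℝ → EReal → ℝ}

theorem integrable (h : P.IsMetric ρ H) (z : EReal) (a : Bool) (x : ℝ) :
    Integrable (fun y => H y z) (P.κ a x) :=
  let ⟨_, hC⟩ := h.bdd z
  integrable_of_abs_le (h.meas z) hC a x

theorem sub_const_mul (h : P.IsMetric ρ H) (h' : P.IsMetric ρ' H') (lam : ℝ) :
    P.IsMetric (fun x a => ρ x a - lam * ρ' x a) (fun x z => H x z - lam * H' x z) where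
  payoff_bdd := by
    obtain ⟨K, hK0, hK⟩ := h.payoff_bdd
    obtain ⟨K', hK0', hK'⟩ := h'.payoff_bdd
    refine ⟨K + |lam| * K', by positivity, fun x a => ?_⟩
    have h₁ := abs_sub (ρ x a) (lam * ρ' x a)
    rw [abs_mul] at h₁
    nlinarith [hK x a, mul_le_mul_of_nonneg_left (hK' x a) (abs_nonneg lam)]
  meas z := (h.meas z).sub ((h'.meas z).const_mul lam)
  bdd z := by
    obtain ⟨K, hK⟩ := h.bdd z
    obtain ⟨K', hK'⟩ := h'.bdd z
    refine ⟨K + |lam| * K', fun x => ?_⟩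
    have h₁ := abs_sub (H x z) (lam * H' x z)
    rw [abs_mul] at h₁
    nlinarith [hK x, mul_le_mul_of_nonneg_left (hK' x) (abs_nonneg lam)]
  eq x z := by
    rw [integral_sub (h.integrable z _ x) ((h'.integrable z _ x).const_mul lam),
      integral_const_mul]
    linarith [h.eq x z, congrArg (lam * ·) (h'.eq x z)]

theorem marg_sub_const_mul (h : P.IsMetric ρ H) (h' : P.IsMetric ρ' H') (lam x : ℝ) (z : EReal) :
    P.marg (fun x a => ρ x a - lam * ρ' x a) (fun x z => H x z - lam * H' x z) x z =
      P.marg ρ H x z - lam * P.marg ρ' H' x z := by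
  simp only [marg]
  rw [integral_sub (h.integrable z _ x) ((h'.integrable z _ x).const_mul lam),
    integral_sub (h.integrable z _ x) ((h'.integrable z _ x).const_mul lam),
    integral_const_mul, integral_const_mul]
  ring

/-- Performance metrics are `w`-bounded uniformly over thresholds. -/
theorem exists_abs_le (h : P.IsMetric ρ H) :
    ∃ C, 0 ≤ C ∧ ∀ x z, |H x z| ≤ C * P.w x := by
  obtain ⟨K, hK0, hK⟩ := h.payoff_bdd
  have hγ : 0 < 1 - P.γ := sub_pos.2 P.hγ1
  refine ⟨K / (1 - P.γ), by positivity, fun x z => ?_⟩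
  set C := K / (1 - P.γ) with hCdef
  have hC0 : 0 ≤ C := by positivity
  have hCK : C * (1 - P.γ) = K := div_mul_cancel₀ _ hγ.ne'
  obtain ⟨B, hB⟩ := h.bdd z
  have := nonpos_of_le_discounted_integral (P := P) (φ := fun x => |H x z| - C * P.w x)
    (C := B + C) ((h.meas z).abs.sub (P.hw_meas.const_mul C)) (fun x => by
      have h₁ := abs_sub (|H x z|) (C * P.w x)
      rw [abs_abs, abs_of_nonneg (mul_nonneg hC0 (w_pos x).le)] at h₁
      linarith [hB x]) (fun x => by
      refine ⟨decide (z < (x : EReal)), ?_⟩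
      rw [integral_sub (h.integrable z _ x).abs ((P.hw_int _ x).const_mul C), integral_const_mul]
      have h₁ := P.hw_drift (decide (z < (x : EReal))) x
      have h₂ : |H x z| ≤ |ρ x (decide (z < (x : EReal)))| +
          P.β * ∫ y, |H y z| ∂(P.κ (decide (z < (x : EReal))) x) := by
        conv_lhs => rw [h.eq x z]
        refine (abs_add_le _ _).trans (add_le_add le_rfl ?_)
        rw [abs_mul, abs_of_nonneg P.hβ0]
        exact mul_le_mul_of_nonneg_left abs_integral_le_integral_abs P.hβ0
      have h₃ := hK x (decide (z < (x : EReal)))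
      have h₄ := mul_le_mul_of_nonneg_left h₁ hC0
      rw [← hCK] at h₃
      linarith) x
  linarith

theorem eq_active (h : P.IsMetric ρ H) {x : ℝ} {z : EReal} (hz : z < x) :
    H x z = ρ x true + P.β * ∫ y, H y z ∂(P.κ true x) := by
  simpa [hz] using h.eq x z

theorem eq_passive (h : P.IsMetric ρ H) {x : ℝ} {z : EReal} (hz : (x : EReal) ≤ z) :
    H x z = ρ x false + P.β * ∫ y, H y z ∂(P.κ false x) := by
  simpa [not_lt.2 hz] using h.eq x z

theorem integral_sub_thresholds (h : P.IsMetric ρ H) (z z' : EReal) (a : Bool) (x : ℝ) :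
    ∫ y, (H y z - H y z') ∂(P.κ a x) =
      (∫ y, H y z ∂(P.κ a x)) - ∫ y, H y z' ∂(P.κ a x) :=
  integral_sub (h.integrable z a x) (h.integrable z' a x)

theorem sub_eq_of_decide_eq (h : P.IsMetric ρ H) {x : ℝ} {z z' : EReal}
    (hz : z < x ↔ z' < x) :
    H x z - H x z' = P.β * ∫ y, (H y z - H y z') ∂(P.κ (decide (z' < (x : EReal))) x) := by
  rw [h.integral_sub_thresholds, h.eq x z, h.eq x z', decide_eq_decide.2 hz]
  ring

theorem abs_sub_le_of_bound {C : ℝ} (hC : ∀ x z, |H x z| ≤ C * P.w x) (z z' : EReal) (x : ℝ) :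
    |H x z - H x z'| ≤ 2 * C * P.w x := by
  have := abs_sub (H x z) (H x z')
  linarith [hC x z, hC x z']

theorem le_of_marg_nonneg (h : P.IsMetric ρ H) {z z' : EReal} (hzz : z ≤ z')
    (hm : ∀ x : ℝ, z < x → (x : EReal) ≤ z' → 0 ≤ P.marg ρ H x z) (x : ℝ) :
    H x z' ≤ H x z := by
  obtain ⟨C, _, hC⟩ := h.exists_abs_le
  refine sub_nonpos.1 (nonpos_of_le_discounted_integral (P := P)
    (φ := fun x => H x z' - H x z) ((h.meas z').sub (h.meas z))
    (abs_sub_le_of_bound hC z' z) (fun x => ?_) x)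
  by_cases hx : z < x
  · by_cases hx' : z' < x
    · exact ⟨_, (h.sub_eq_of_decide_eq (iff_of_true hx' hx)).le⟩
    · refine ⟨false, ?_⟩
      have h₁ := hm x hx (not_lt.1 hx')
      rw [h.integral_sub_thresholds, h.eq_active hx, h.eq_passive (not_lt.1 hx')]
      simp only [marg] at h₁
      linarith
  · exact ⟨_, (h.sub_eq_of_decide_eq
      (iff_of_false (fun hx' => hx (hzz.trans_lt hx')) hx)).le⟩

theorem le_of_marg_nonpos (h : P.IsMetric ρ H) {z z' : EReal} (hzz : z ≤ z')
    (hm : ∀ x : ℝ, z < x → (x : EReal) ≤ z' → P.marg ρ H x z' ≤ 0) (x : ℝ) :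
    H x z ≤ H x z' := by
  obtain ⟨C, _, hC⟩ := h.exists_abs_le
  refine sub_nonpos.1 (nonpos_of_le_discounted_integral (P := P)
    (φ := fun x => H x z - H x z') ((h.meas z).sub (h.meas z'))
    (abs_sub_le_of_bound hC z z') (fun x => ?_) x)
  by_cases hx : z < x
  · by_cases hx' : z' < x
    · exact ⟨_, (h.sub_eq_of_decide_eq (iff_of_true hx hx')).le⟩
    · refine ⟨true, ?_⟩
      have h₁ := hm x hx (not_lt.1 hx')
      rw [h.integral_sub_thresholds, h.eq_active hx, h.eq_passive (not_lt.1 hx')]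
      simp only [marg] at h₁
      linarith
  · exact ⟨_, (h.sub_eq_of_decide_eq
      (iff_of_false hx (fun hx' => hx (hzz.trans_lt hx')))).le⟩

/-- If neither switching to the `z'`-policy nor to the `z`-policy is profitable, the marginal
metrics of the two policies agree. -/
theorem marg_eq_of_nonneg_of_nonpos (h : P.IsMetric ρ H) {z z' : EReal} (hzz : z ≤ z')
    (hm : ∀ x : ℝ, z < x → (x : EReal) ≤ z' → 0 ≤ P.marg ρ H x z)
    (hm' : ∀ x : ℝ, z < x → (x : EReal) ≤ z' → P.marg ρ H x z' ≤ 0) (x : ℝ) :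
    P.marg ρ H x z = P.marg ρ H x z' := by
  have : ∀ y, H y z = H y z' := fun y =>
    le_antisymm (h.le_of_marg_nonpos hzz hm' y) (h.le_of_marg_nonneg hzz hm y)
  simp only [marg, this]

/-- Performance metrics converge along thresholds whose decisions converge pointwise. -/
theorem tendsto (h : P.IsMetric ρ H) {ι : Type*} {l : Filter ι} [l.IsCountablyGenerated]
    {ζ : ι → EReal} {z : EReal}
    (hζ : ∀ x : ℝ, ∀ᶠ i in l, (ζ i < x ↔ z < x)) (x : ℝ) :
    Tendsto (fun i => H x (ζ i)) l (𝓝 (H x z)) := by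
  obtain ⟨C, hC0, hC⟩ := h.exists_abs_le
  set B : ℕ → ℝ → ℝ := fun k x => 2 * C * P.γ ^ k * P.w x with hB
  have hk : ∀ (k : ℕ) (x : ℝ),
      Tendsto (fun i => max |H x (ζ i) - H x z| (B k x)) l (𝓝 (B k x)) := by
    intro k
    induction k with
    | zero =>
      intro x
      refine tendsto_const_nhds.congr fun i => ?_
      have := abs_sub_le_of_bound hC (ζ i) z x
      simp [hB, max_eq_right this]
    | succ k ih =>
      intro x
      set a := decide (z < (x : EReal))
      have hγk : P.γ ^ k ≤ 1 := pow_le_one₀ gamma_nonneg P.hγ1.le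
      have hγk0 : 0 ≤ P.γ ^ k := pow_nonneg gamma_nonneg k
      have hBk : ∀ y, B k y ≤ 2 * C * P.w y := fun y => by
        have := mul_le_mul_of_nonneg_left hγk (mul_nonneg hC0 (w_pos (P := P) y).le)
        simp only [hB]; linarith
      have hBk0 : ∀ y, 0 ≤ B k y := fun y => by
        have := w_pos (P := P) y
        simp only [hB]; positivity
      have hmeas : ∀ i, Measurable fun y => max |H y (ζ i) - H y z| (B k y) := fun i =>
        ((h.meas _).sub (h.meas _)).abs.max (P.hw_meas.const_mul _)
      have hle : ∀ i y, |max |H y (ζ i) - H y z| (B k y)| ≤ 2 * C * P.w y := fun i y => by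
        rw [abs_of_nonneg ((abs_nonneg _).trans (le_max_left _ _))]
        exact max_le (abs_sub_le_of_bound hC _ _ y) (hBk y)
      have hlim : Tendsto (fun i => P.β * ∫ y, max |H y (ζ i) - H y z| (B k y) ∂(P.κ a x)) l
          (𝓝 (P.β * ∫ y, B k y ∂(P.κ a x))) := by
        refine Tendsto.const_mul _ (tendsto_integral_filter_of_dominated_convergence
          (fun y => 2 * C * P.w y) (Eventually.of_forall fun i => (hmeas i).aestronglyMeasurable)
          (Eventually.of_forall fun i => ae_of_all _ (hle i))
          ((P.hw_int a x).const_mul _) (ae_of_all _ ih))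
      have hBx : P.β * ∫ y, B k y ∂(P.κ a x) ≤ B (k + 1) x := by
        refine (discounted_integral_le ((P.hw_int a x).const_mul _) (by positivity)
          fun y => le_rfl).trans (le_of_eq ?_)
        simp only [hB]; ring
      have hlim' : Tendsto (fun i => max (P.β * ∫ y, max |H y (ζ i) - H y z| (B k y) ∂(P.κ a x))
          (B (k + 1) x)) l (𝓝 (B (k + 1) x)) := by
        simpa [max_eq_right hBx] using hlim.max (tendsto_const_nhds (x := B (k + 1) x))
      refine tendsto_of_tendsto_of_tendsto_of_le_of_le' tendsto_const_nhds hlim'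
        (Eventually.of_forall fun i => le_max_right _ _) ?_
      filter_upwards [hζ x] with i hi
      refine max_le_max ?_ le_rfl
      rw [h.sub_eq_of_decide_eq hi, abs_mul, abs_of_nonneg P.hβ0]
      refine mul_le_mul_of_nonneg_left (abs_integral_le_integral_abs.trans ?_) P.hβ0
      exact integral_mono
        ((h.integrable _ _ x).sub (h.integrable _ _ x)).abs
        (integrable_of_abs_le (hmeas i) (hle i) _ x) fun y => le_max_left _ _
  rw [Metric.tendsto_nhds]
  intro ε hε
  have hB0 : Tendsto (fun k => B k x) atTop (𝓝 0) := by
    simpa [hB] using ((tendsto_pow_atTop_nhds_zero_of_lt_one gamma_nonneg P.hγ1).const_mul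
      (2 * C)).mul_const (P.w x)
  obtain ⟨k, hkε⟩ := (hB0.eventually (gt_mem_nhds hε)).exists
  filter_upwards [(hk k x).eventually (gt_mem_nhds hkε)] with i hi
  exact (le_max_left _ _).trans_lt hi

theorem tendsto_marg (h : P.IsMetric ρ H) {ι : Type*} {l : Filter ι} [l.IsCountablyGenerated]
    {ζ : ι → EReal} {z : EReal}
    (hζ : ∀ x : ℝ, ∀ᶠ i in l, (ζ i < x ↔ z < x)) (x : ℝ) :
    Tendsto (fun i => P.marg ρ H x (ζ i)) l (𝓝 (P.marg ρ H x z)) := by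
  obtain ⟨C, -, hC⟩ := h.exists_abs_le
  have hint : ∀ a, Tendsto (fun i => ∫ y, H y (ζ i) ∂(P.κ a x)) l
      (𝓝 (∫ y, H y z ∂(P.κ a x))) := fun a =>
    tendsto_integral_filter_of_dominated_convergence (fun y => C * P.w y)
      (Eventually.of_forall fun i => (h.meas _).aestronglyMeasurable)
      (Eventually.of_forall fun i => ae_of_all _ fun y => hC y _)
      ((P.hw_int a x).const_mul _) (ae_of_all _ (h.tendsto hζ))
  exact (((hint true).sub (hint false)).const_mul P.β).const_add _

end IsMetric

theorem G_antitone (h : P.PCLI1) (x : ℝ) : Antitone fun z => P.G x z :=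
  fun z _ hz => isMetric_G.le_of_marg_nonneg hz (fun y _ _ => (h y z).le) x

theorem G_right_continuous (x z : ℝ) :
    ContinuousWithinAt (fun s : ℝ => P.G x s) (Ici z) z := by
  refine isMetric_G.tendsto (l := 𝓝[Ici z] z) (ζ := fun s : ℝ => (s : EReal)) (fun y => ?_) x
  rcases lt_or_ge z y with hy | hy
  · filter_upwards [mem_nhdsWithin_of_mem_nhds (Iio_mem_nhds hy)] with s hs
    simpa [hy] using hs
  · filter_upwards [self_mem_nhdsWithin] with s hs
    have hys : y ≤ s := hy.trans hs
    simp [hy.not_gt, hys.not_gt]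

/-- Monotonicity of the MP index turns the Lebesgue–Stieltjes condition into two-sided bounds. -/
theorem F_sub_bounds (h : P.PCLIndexable) (x : ℝ) {s t : ℝ} (hst : s ≤ t) :
    P.mStar s * (P.G x s - P.G x t) ≤ P.F x s - P.F x t ∧
      P.F x s - P.F x t ≤ P.mStar t * (P.G x s - P.G x t) := by
  obtain ⟨h₁, ⟨hmono, hcont, -⟩, h₃⟩ := h
  rcases hst.eq_or_lt with rfl | hlt
  · simp
  let S : StieltjesFunction ℝ :=
    { toFun := fun z => -P.G x z
      mono' := fun a b hab => neg_le_neg (G_antitone h₁ x (EReal.coe_le_coe_iff.2 hab))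
      right_continuous' := fun z => (G_right_continuous x z).neg }
  have hS : ∀ a b : ℝ, S.measure (Ioc a b) = ENNReal.ofReal (P.G x a - P.G x b) := fun a b => by
    rw [S.measure_Ioc]
    congr 1
    change -P.G x b - -P.G x a = _
    ring
  have hF := h₃ x S.measure (fun a b _ => hS a b) s t hlt
  have hreal : S.measure.real (Ioc s t) = P.G x s - P.G x t := by
    rw [Measure.real, hS, ENNReal.toReal_ofReal
      (sub_nonneg.2 (G_antitone h₁ x (EReal.coe_le_coe_iff.2 hst)))]
  have hfin : S.measure (Ioc s t) ≠ ⊤ := by rw [hS]; exact ENNReal.ofReal_ne_top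
  have hint : IntegrableOn P.mStar (Ioc s t) S.measure :=
    (hcont.continuousOn.integrableOn_compact isCompact_Icc).mono_set Ioc_subset_Icc_self
  have hlo := setIntegral_mono_on (integrableOn_const hfin (C := P.mStar s)) hint
    measurableSet_Ioc fun y hy => hmono hy.1.le
  have hhi := setIntegral_mono_on hint (integrableOn_const hfin (C := P.mStar t))
    measurableSet_Ioc fun y hy => hmono hy.2
  rw [setIntegral_const, hreal, smul_eq_mul] at hlo hhi
  constructor <;> linarith

/-- The map `z ↦ f(x,z) - m*(z) g(x,z)` is nonincreasing. -/
theorem f_sub_mStar_mul_g_antitone (h : P.PCLIndexable) (x : ℝ) :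
    Antitone fun z : ℝ => P.f x z - P.mStar z * P.g x z := by
  let I : Bool → ℝ → ℝ := fun a z => ∫ y, P.G y z ∂(P.κ a x)
  have hI : ∀ a {s t : ℝ}, s ≤ t → I a t ≤ I a s := fun a s t hst =>
    integral_mono (isMetric_G.integrable _ a x) (isMetric_G.integrable _ a x) fun y =>
      G_antitone h.1 y (EReal.coe_le_coe_iff.2 hst)
  have hβI : ∀ a {s t : ℝ}, s ≤ t → P.β * I a t ≤ P.β * I a s := fun a s t hst =>
    mul_le_mul_of_nonneg_left (hI a hst) P.hβ0
  refine antitone_of_increment_le_mul (μ := P.mStar)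
    (a := fun z => P.β * I true z + P.β * I false z) h.2.1.1 h.2.1.2.1
    (fun s t hst => add_le_add (hβI true hst) (hβI false hst)) fun s t hst => ?_
  have hJ : ∀ a, P.mStar s * (P.β * I a s - P.β * I a t) ≤
        P.β * (∫ y, P.F y s ∂(P.κ a x)) - P.β * ∫ y, P.F y t ∂(P.κ a x) ∧
      P.β * (∫ y, P.F y s ∂(P.κ a x)) - P.β * (∫ y, P.F y t ∂(P.κ a x)) ≤
        P.mStar t * (P.β * I a s - P.β * I a t) := by
    intro a
    have hFi : Integrable (fun y => P.F y s - P.F y t) (P.κ a x) :=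
      (isMetric_F.integrable _ a x).sub (isMetric_F.integrable _ a x)
    have hGi : Integrable (fun y => P.G y s - P.G y t) (P.κ a x) :=
      (isMetric_G.integrable _ a x).sub (isMetric_G.integrable _ a x)
    have hlo := integral_mono (hGi.const_mul (P.mStar s)) hFi fun y => (F_sub_bounds h y hst).1
    have hhi := integral_mono hFi (hGi.const_mul (P.mStar t)) fun y => (F_sub_bounds h y hst).2
    rw [integral_const_mul, isMetric_G.integral_sub_thresholds,
      isMetric_F.integral_sub_thresholds] at hlo hhi
    have hlo' := mul_le_mul_of_nonneg_left hlo P.hβ0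
    have hhi' := mul_le_mul_of_nonneg_left hhi P.hβ0
    simp only [I]
    constructor <;> linarith
  have hμ : 0 ≤ P.mStar t - P.mStar s := sub_nonneg.2 (h.2.1.1 hst)
  have hg := mul_nonneg hμ (h.1 x s).le
  have h₁ := mul_nonneg hμ (sub_nonneg.2 (hβI true hst))
  have e₁ := hJ true
  have e₀ := hJ false
  simp only [f, g, I] at *
  nlinarith

theorem f_eq_mStar_mul_g (h : P.PCLI1) (x : ℝ) : P.f x x = P.mStar x * P.g x x :=
  (div_mul_cancel₀ _ (h x x).ne').symm

theorem f_le_mStar_mul_g (h : P.PCLIndexable) {x z : ℝ} (hxz : x ≤ z) :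
    P.f x z ≤ P.mStar z * P.g x z := by
  have := f_sub_mStar_mul_g_antitone h x hxz
  simp only [f_eq_mStar_mul_g h.1 x] at this
  linarith

theorem mStar_mul_g_le_f (h : P.PCLIndexable) {x z : ℝ} (hzx : z ≤ x) :
    P.mStar z * P.g x z ≤ P.f x z := by
  have := f_sub_mStar_mul_g_antitone h x hzx
  simp only [f_eq_mStar_mul_g h.1 x] at this
  linarith

theorem f_sub_mul_g_eq (lam : ℝ) {z z' : EReal} (hzz : z ≤ z')
    (hm : ∀ x : ℝ, z < x → (x : EReal) ≤ z' → lam * P.g x z ≤ P.f x z)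
    (hm' : ∀ x : ℝ, z < x → (x : EReal) ≤ z' → P.f x z' ≤ lam * P.g x z') (x : ℝ) :
    P.f x z - lam * P.g x z = P.f x z' - lam * P.g x z' := by
  have e := isMetric_F.marg_sub_const_mul (isMetric_G (P := P)) lam
  have := (isMetric_F.sub_const_mul (isMetric_G (P := P)) lam).marg_eq_of_nonneg_of_nonpos hzz
    (fun y hy hy' => by rw [e]; exact sub_nonneg.2 (hm y hy hy'))
    (fun y hy hy' => by rw [e]; exact sub_nonpos.2 (hm' y hy hy')) x
  rwa [e, e] at this

theorem exists_m_le_mStar (h : P.PCLIndexable) {z : EReal} {z' : ℝ} (hz : z < z') :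
    ∃ x : ℝ, z < x ∧ P.m x z ≤ P.mStar z' := by
  by_contra! hcon
  have hlt : ∀ x : ℝ, z < x → P.mStar z' * P.g x z < P.f x z := fun x hx =>
    (lt_div_iff₀ (h.1 x z)).1 (hcon x hx)
  have := f_sub_mul_g_eq (P.mStar z') hz.le (fun x hx _ => (hlt x hx).le)
    (fun x _ hx => f_le_mStar_mul_g h (EReal.coe_le_coe_iff.1 hx)) z'
  linarith [hlt z' hz, f_eq_mStar_mul_g h.1 z']

theorem exists_mStar_le_m_top (h : P.PCLIndexable) (z : ℝ) :
    ∃ x : ℝ, P.mStar z ≤ P.m x ⊤ := by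
  by_contra! hcon
  have hlt : ∀ x : ℝ, P.f x ⊤ < P.mStar z * P.g x ⊤ := fun x =>
    (div_lt_iff₀ (h.1 x ⊤)).1 (hcon x)
  have := f_sub_mul_g_eq (P.mStar z) (le_top : (z : EReal) ≤ ⊤)
    (fun x hx _ => mStar_mul_g_le_f h (EReal.coe_lt_coe_iff.1 hx).le)
    (fun x _ _ => (hlt x).le) z
  linarith [hlt z, f_eq_mStar_mul_g h.1 z]

theorem le_m_bot (h : P.PCLIndexable) {L : ℝ} (hL : ∀ z, L ≤ P.mStar z) (x : ℝ) :
    L ≤ P.m x ⊥ := by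
  have hζ : ∀ y : ℝ, ∀ᶠ s : ℝ in atBot, ((s : EReal) < y ↔ (⊥ : EReal) < y) := fun y => by
    filter_upwards [eventually_lt_atBot y] with s hs
    simpa using hs
  refine (le_div_iff₀ (h.1 x ⊥)).2 (le_of_tendsto_of_tendsto
    ((isMetric_G.tendsto_marg hζ x).const_mul L) (isMetric_F.tendsto_marg hζ x) ?_)
  filter_upwards [eventually_le_atBot x] with s hs
  exact (mul_le_mul_of_nonneg_right (hL s) (h.1 x s).le).trans (mStar_mul_g_le_f h hs)

theorem m_top_le (h : P.PCLIndexable) {L : ℝ} (hL : ∀ z, P.mStar z ≤ L) (x : ℝ) :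
    P.m x ⊤ ≤ L := by
  have hζ : ∀ y : ℝ, ∀ᶠ s : ℝ in atTop, ((s : EReal) < y ↔ (⊤ : EReal) < y) := fun y => by
    filter_upwards [eventually_ge_atTop y] with s hs
    simpa using hs
  refine (div_le_iff₀ (h.1 x ⊤)).2 (le_of_tendsto_of_tendsto
    (isMetric_F.tendsto_marg hζ x) ((isMetric_G.tendsto_marg hζ x).const_mul L) ?_)
  filter_upwards [eventually_ge_atTop x] with s hs
  exact (f_le_mStar_mul_g h hs).trans (mul_le_mul_of_nonneg_right (hL s) (h.1 x s).le)

theorem iInf_m_bot (h : P.PCLIndexable) :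
    ⨅ x : ℝ, ((P.m x ⊥ : ℝ) : EReal) = ⨅ z : ℝ, (P.mStar z : EReal) := by
  refine le_antisymm (le_iInf fun z => ?_) (le_iInf fun x => ?_)
  · obtain ⟨x, -, hx⟩ := exists_m_le_mStar h (EReal.bot_lt_coe z)
    exact iInf_le_of_le x (EReal.coe_le_coe_iff.2 hx)
  · refine le_of_not_gt fun hlt => ?_
    obtain ⟨L, hxL, hL⟩ := EReal.lt_iff_exists_real_btwn.1 hlt
    exact (EReal.coe_lt_coe_iff.1 hxL).not_ge (le_m_bot h (fun z =>
      EReal.coe_le_coe_iff.1 (hL.le.trans (iInf_le _ z))) x)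

theorem iSup_m_top (h : P.PCLIndexable) :
    ⨆ x : ℝ, ((P.m x ⊤ : ℝ) : EReal) = ⨆ z : ℝ, (P.mStar z : EReal) := by
  refine le_antisymm (iSup_le fun x => ?_) (iSup_le fun z => ?_)
  · refine le_of_not_gt fun hlt => ?_
    obtain ⟨L, hL, hLx⟩ := EReal.lt_iff_exists_real_btwn.1 hlt
    exact (EReal.coe_lt_coe_iff.1 hLx).not_ge (m_top_le h (fun z =>
      EReal.coe_le_coe_iff.1 ((le_iSup (fun z : ℝ => (P.mStar z : EReal)) z).trans hL.le)) x)
  · obtain ⟨x, hx⟩ := exists_mStar_le_m_top h z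
    exact le_iSup_of_le x (EReal.coe_le_coe_iff.2 hx)

end Bandit

/-- Under PCL-indexability: for finite `z`, `max_{x ≤ z} m(x,z) = m*(z) =
inf_{x > z} m(x,z)` (the maximum attained at `x = z`); moreover
`inf_x m(x,−∞) = lim_{z→−∞} m*(z)` and `sup_x m(x,∞) = lim_{z→∞} m*(z)`
(the latter possibly `+∞`, hence stated in `EReal`). -/
theorem mpIndex_dual_characterization (P : Bandit) (h : P.PCLIndexable) :
    (∀ z : ℝ, IsGreatest ((fun x : ℝ => P.m x z) '' Set.Iic z) (P.mStar z) ∧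
      IsGLB ((fun x : ℝ => P.m x z) '' Set.Ioi z) (P.mStar z)) ∧
    Filter.Tendsto (fun z : ℝ => (P.mStar z : EReal)) Filter.atBot
      (nhds (⨅ x : ℝ, ((P.m x ⊥ : ℝ) : EReal))) ∧
    Filter.Tendsto (fun z : ℝ => (P.mStar z : EReal)) Filter.atTop
      (nhds (⨆ x : ℝ, ((P.m x ⊤ : ℝ) : EReal))) := by
  obtain ⟨h₁, ⟨hmono, hcont, -⟩, -⟩ := id h
  have hmono' : Monotone fun z : ℝ => (P.mStar z : EReal) := fun _ _ hst =>
    EReal.coe_le_coe_iff.2 (hmono hst)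
  refine ⟨fun z => ⟨⟨⟨z, self_mem_Iic, rfl⟩, ?_⟩, ?_, fun b hb => ?_⟩, ?_, ?_⟩
  · rintro _ ⟨x, hx, rfl⟩
    exact (div_le_iff₀ (h₁ x z)).2 (Bandit.f_le_mStar_mul_g h hx)
  · rintro _ ⟨x, hx, rfl⟩
    exact (le_div_iff₀ (h₁ x z)).2 (Bandit.mStar_mul_g_le_f h (le_of_lt hx))
  · refine ge_of_tendsto (hcont.continuousWithinAt (s := Ioi z) (x := z)) ?_
    filter_upwards [self_mem_nhdsWithin] with z' hz'
    obtain ⟨x, hx, hle⟩ := Bandit.exists_m_le_mStar h (EReal.coe_lt_coe_iff.2 hz')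
    exact (hb ⟨x, EReal.coe_lt_coe_iff.1 hx, rfl⟩).trans hle
  · rw [Bandit.iInf_m_bot h]
    exact tendsto_atBot_iInf hmono'
  · rw [Bandit.iSup_m_top h]
    exact tendsto_atTop_iSup hmono'
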